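/- arXiv:1703.08931 — 11 statements merged into one kernel-verified Lean document; each statement's English description precedes it below -/
import Mathlib

section
/- Let y be a suffix of a generalized palindrome x. Then y is a border of x if and only if y is a generalized palindrome. -/
/-- A string `x` is a generalized palindrome (w.r.t. the involution `f`)
if `x = f(x^R)`. -/
def GenPal {α : Type*} (f : α → α) (x : List α) : Prop :=
  x = (x.reverse).map f

/-- Let `y` be a suffix of a generalized palindrome `x`. Then `y` is a border of `x`
(i.e. both a prefix and a suffix of `x`) iff `y` is a generalized palindrome. -/
theorem suffix_isBorder_iff_genPal {α : Type*} (f : α → α) (hf : Function.Involutive f)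
    (x y : List α) (hx : GenPal f x) (hy : y <:+ x) :
    (y <+: x ∧ y <:+ x) ↔ GenPal f y := by
  have key : (y.reverse).map f <+: x := by
    have h : (y.reverse).map f <+: (x.reverse).map f :=
      (List.reverse_prefix.mpr hy).map f
    have hx' : x = (x.reverse).map f := hx
    rw [← hx'] at h
    exact h
  constructor
  · rintro ⟨h1, _⟩
    exact (List.prefix_of_prefix_length_le h1 key (by simp)).eq_of_length (by simp)
  · intro h
    have h' : y = (y.reverse).map f := h
    rw [← h'] at key
    exact ⟨key, hy⟩
end

section
/- Let x be a string with a border y such that |x| ≤ 2|y|. Then x is a generalized palindrome if and only if y is a generalized palindrome. -/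
/-- Let `x` be a string with a border `y` (a prefix and a suffix of `x`)
such that `|x| ≤ 2|y|`. Then `x` is a generalized palindrome iff `y` is. -/
theorem genPal_iff_border_genPal {α : Type*} (f : α → α) (hf : Function.Involutive f)
    (x y : List α) (hpre : y <+: x) (hsuf : y <:+ x) (hlen : x.length ≤ 2 * y.length) :
    GenPal f x ↔ GenPal f y := by
  unfold GenPal
  obtain ⟨t, ht⟩ := hpre
  obtain ⟨s, hs⟩ := hsuf
  have l1 : y.length + t.length = x.length := by rw [← ht]; simp
  have l2 : s.length + y.length = x.length := by rw [← hs]; simp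
  constructor
  · intro h
    have h2 : y ++ t = (y.reverse).map f ++ (s.reverse).map f := by
      rw [ht, ← List.map_append, ← List.reverse_append, hs]
      exact h
    exact (List.append_inj h2 (by simp)).1
  · intro h
    have hsp : s <+: y := List.prefix_of_prefix_length_le (l₃ := x) ⟨y, hs⟩ ⟨t, ht⟩ (by omega)
    have htp : t <:+ y := List.suffix_of_suffix_length_le (l₃ := x) ⟨y, ht⟩ ⟨s, hs⟩ (by omega)
    obtain ⟨u, hu⟩ := hsp
    obtain ⟨v, hv⟩ := htp
    have h2 : s ++ u = (t.reverse).map f ++ (v.reverse).map f := by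
      rw [hu, ← List.map_append, ← List.reverse_append, hv]
      exact h
    have h3 : s = (t.reverse).map f := (List.append_inj h2 (by simp; omega)).1
    calc x = s ++ y := hs.symm
      _ = (t.reverse).map f ++ (y.reverse).map f := by rw [← h3, ← h]
      _ = (x.reverse).map f := by
        rw [← List.map_append, ← List.reverse_append, ht]
end

section
/- Let y be a proper suffix of a nonempty generalized palindrome x. Then |x| − |y| is a period of x if and only if y is a generalized palindrome. -/
/-- A positive integer `p` is a period of `x` if `x[i] = x[i+p]`
for all `i = 1, …, |x| − p` (here written 0-based). -/
def IsPeriod {α : Type*} (x : List α) (p : ℕ) : Prop :=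
  0 < p ∧ ∀ (i : ℕ) (h : i + p < x.length), x[i]'(by omega) = x[i + p]'h

/-- Let `y` be a proper suffix of a nonempty generalized palindrome `x`.
Then `|x| − |y|` is a period of `x` iff `y` is a generalized palindrome. -/
theorem isPeriod_iff_suffix_genPal {α : Type*} (f : α → α) (hf : Function.Involutive f)
    (x y : List α) (hx : GenPal f x) (hxne : x ≠ [])
    (hsuf : y <:+ x) (hne : y ≠ x) :
    IsPeriod x (x.length - y.length) ↔ GenPal f y := by
  obtain ⟨t, rfl⟩ := hsuf
  have ht : 0 < t.length := by
    rcases t with _ | ⟨a, t⟩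
    · simp at hne
    · simp
  have hp : (t ++ y).length - y.length = t.length := by simp
  rw [hp]
  -- the prefix of `x` of length `|y|` is `f(y^R)`
  have key : ∀ (i : ℕ) (h : i < y.length),
      (t ++ y)[i]'(by simp; omega) = (y.reverse.map f)[i]'(by simpa using h) := by
    intro i h
    have hx' : t ++ y = y.reverse.map f ++ t.reverse.map f := by
      have := hx
      unfold GenPal at this
      rw [List.reverse_append, List.map_append] at this
      exact this
    rw [List.getElem_of_eq hx', List.getElem_append_left]
  have shift : ∀ (i : ℕ) (h : i < y.length),
      (t ++ y)[i + t.length]'(by simp; omega) = y[i] := by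
    intro i h
    rw [List.getElem_append_right (by omega)]
    simp
  constructor
  · rintro ⟨_, h⟩
    unfold GenPal
    apply List.ext_getElem (by simp)
    intro i h1 h2
    rw [← key i h1, ← shift i h1]
    exact (h i (by simp; omega)).symm
  · intro hy
    refine ⟨ht, fun i h => ?_⟩
    have h1 : i < y.length := by simp at h; omega
    rw [key i h1, shift i h1]
    exact (List.getElem_of_eq hy h1).symm
end

section
/- Let y be a proper suffix of a nonempty generalized palindrome x. Then |x| − |y| is the smallest period of x if and only if y is the longest proper suffix of x that is a generalized palindrome. -/
theorem genPal_iff_getElem {α : Type*} (f : α → α) (x : List α) :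
    GenPal f x ↔ ∀ (i : ℕ) (h : i < x.length),
      x[i] = f (x[x.length - 1 - i]'(by omega)) := by
  unfold GenPal
  constructor
  · intro hx i h
    have h1 : x[i]? = ((x.reverse).map f)[i]? := congrArg (fun l => l[i]?) hx
    rw [List.getElem?_eq_getElem h, List.getElem?_eq_getElem (by simpa using h)] at h1
    simpa using h1
  · intro hx
    apply List.ext_getElem
    · simp
    · intro i h1 h2
      simpa using hx i h1

theorem genPal_drop_iff {α : Type*} (f : α → α) (hf : Function.Involutive f)
    (x : List α) (hx : GenPal f x) (p : ℕ) (hp : 0 < p) :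
    GenPal f (x.drop p) ↔ IsPeriod x p := by
  rw [genPal_iff_getElem] at hx ⊢
  have key : ∀ (i : ℕ) (h : i < x.length),
      f (x[x.length - 1 - i]'(by omega)) = x[i] := fun i h => (hx i h).symm
  constructor
  · intro h
    refine ⟨hp, fun i hi => ?_⟩
    have h1 := h i (by simp; omega)
    simp only [List.getElem_drop, List.length_drop] at h1
    have e : p + (x.length - p - 1 - i) = x.length - 1 - i := by omega
    simp only [e, key i (by omega)] at h1
    simp only [Nat.add_comm i p, h1]
  · rintro ⟨_, h⟩ i hi
    simp only [List.length_drop] at hi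
    simp only [List.getElem_drop, List.length_drop]
    have e : p + (x.length - p - 1 - i) = x.length - 1 - i := by omega
    simp only [e, key i (by omega)]
    have h1 := h i (by omega)
    simp only [Nat.add_comm i p] at h1
    exact h1.symm

theorem genPal_suffix_iff {α : Type*} (f : α → α) (hf : Function.Involutive f)
    (x z : List α) (hx : GenPal f x) (hz : z <:+ x) (hne : z ≠ x) :
    z.length < x.length ∧ (GenPal f z ↔ IsPeriod x (x.length - z.length)) := by
  have hlt : z.length < x.length :=
    lt_of_le_of_ne hz.length_le (fun h => hne (hz.eq_of_length h))
  refine ⟨hlt, ?_⟩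
  rw [← genPal_drop_iff f hf x hx _ (by omega), ← List.suffix_iff_eq_drop.mp hz]

/-- Let `y` be a proper suffix of a nonempty generalized palindrome `x`.
Then `|x| − |y|` is the smallest period of `x` iff `y` is the longest proper suffix
of `x` that is a generalized palindrome. -/
theorem smallest_period_iff_longest_genPal_suffix {α : Type*} (f : α → α)
    (hf : Function.Involutive f) (x y : List α) (hx : GenPal f x) (hxne : x ≠ [])
    (hsuf : y <:+ x) (hne : y ≠ x) :
    (IsPeriod x (x.length - y.length) ∧
        ∀ p : ℕ, IsPeriod x p → x.length - y.length ≤ p) ↔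
      (GenPal f y ∧
        ∀ y' : List α, y' <:+ x → y' ≠ x → GenPal f y' → y'.length ≤ y.length) := by
  obtain ⟨hlt, hy⟩ := genPal_suffix_iff f hf x y hx hsuf hne
  rw [hy]
  refine and_congr_right fun _ => ⟨fun h y' hs hn hg => ?_, fun h p hp => ?_⟩
  · obtain ⟨hlt', hy'⟩ := genPal_suffix_iff f hf x y' hx hs hn
    have := h _ (hy'.mp hg)
    omega
  · have hp0 := hp.1
    have hxl : 0 < x.length := List.length_pos_iff.mpr hxne
    have hd := h (x.drop p) (List.drop_suffix p x)
      (fun e => by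
        have := congrArg List.length e
        simp only [List.length_drop] at this
        omega)
      ((genPal_drop_iff f hf x hx p hp0).mpr hp)
    simp only [List.length_drop] at hd
    omega
end

section
/- Let x be a nonempty generalized palindrome, y the longest proper suffix of x that is a generalized palindrome, and (assuming y is nonempty) z the longest proper suffix of y that is a generalized palindrome. Let u and v be the strings with x = u·y and y = v·z. Then |u| ≥ |v|. -/
/-- Let `x` be a nonempty generalized palindrome, `y` the longest proper suffix of `x`
that is a generalized palindrome (assumed nonempty), `z` the longest proper suffix of `y`
that is a generalized palindrome, and `u`, `v` with `x = u ++ y`, `y = v ++ z`.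
Then `|u| ≥ |v|`. -/
theorem length_u_ge_length_v {α : Type*} (f : α → α) (hf : Function.Involutive f)
    (x y z u v : List α)
    (hx : GenPal f x) (hxne : x ≠ [])
    (hysuf : y <:+ x) (hyne : y ≠ x) (hypal : GenPal f y)
    (hymax : ∀ y' : List α, y' <:+ x → y' ≠ x → GenPal f y' → y'.length ≤ y.length)
    (hyne' : y ≠ [])
    (hzsuf : z <:+ y) (hzne : z ≠ y) (hzpal : GenPal f z)
    (hzmax : ∀ z' : List α, z' <:+ y → z' ≠ y → GenPal f z' → z'.length ≤ z.length)
    (hu : x = u ++ y) (hv : y = v ++ z) :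
    v.length ≤ u.length := by
  by_cases hlen : y.length ≤ u.length
  · have := congrArg List.length hv
    simp only [List.length_append] at this
    omega
  push Not at hlen
  unfold GenPal at hx hypal
  have hune : u ≠ [] := by
    rintro rfl
    exact hyne (by simpa using hu.symm)
  -- `x = y ++ f(u^R)`
  have h1 : u ++ y = y ++ u.reverse.map f := by
    rw [hu, List.reverse_append, List.map_append, ← hypal] at hx
    exact hx
  -- `y = u ++ w`
  obtain ⟨w, hw⟩ : u <+: y := by
    refine List.prefix_of_prefix_length_le (l₃ := u ++ y) (List.prefix_append _ _) ?_ hlen.le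
    rw [h1]
    exact List.prefix_append _ _
  have h2 : y = w ++ u.reverse.map f := by
    have h3 := h1
    nth_rewrite 2 [← hw] at h3
    rw [List.append_assoc] at h3
    exact List.append_cancel_left h3
  have hwpal : GenPal f w := by
    unfold GenPal
    have h4 : u ++ w = u ++ w.reverse.map f := by
      have h5 := hypal
      nth_rewrite 2 [h2] at h5
      rw [← hw] at h5
      simpa [Function.comp_def, hf.comp_self, hf _] using h5
    exact List.append_cancel_left h4
  have hl := congrArg List.length hw
  have hl2 := congrArg List.length hv
  simp only [List.length_append] at hl hl2
  have hup := List.length_pos_iff.mpr hune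
  have := hzmax w ⟨u, hw⟩ (by intro h; rw [h] at hl; omega) hwpal
  omega
end

section
/- Let x be a nonempty generalized palindrome, y the longest proper suffix of x that is a generalized palindrome, and (assuming y is nonempty) z the longest proper suffix of y that is a generalized palindrome. Let u and v be the strings with x = u·y and y = v·z. If |u| > |v|, then |u| > |z|. -/
/-- Let `x` be a nonempty generalized palindrome, `y` the longest proper suffix of `x`
that is a generalized palindrome (assumed nonempty), `z` the longest proper suffix of `y`
that is a generalized palindrome, and `u`, `v` with `x = u ++ y`, `y = v ++ z`.
If `|u| > |v|`, then `|u| > |z|`. -/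
theorem length_u_gt_length_z {α : Type*} (f : α → α) (hf : Function.Involutive f)
    (x y z u v : List α)
    (hx : GenPal f x) (hxne : x ≠ [])
    (hysuf : y <:+ x) (hyne : y ≠ x) (hypal : GenPal f y)
    (hymax : ∀ y' : List α, y' <:+ x → y' ≠ x → GenPal f y' → y'.length ≤ y.length)
    (hyne' : y ≠ [])
    (hzsuf : z <:+ y) (hzne : z ≠ y) (hzpal : GenPal f z)
    (hzmax : ∀ z' : List α, z' <:+ y → z' ≠ y → GenPal f z' → z'.length ≤ z.length)
    (hu : x = u ++ y) (hv : y = v ++ z)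
    (hgt : v.length < u.length) :
    z.length < u.length := by
  by_contra hcon
  have hcon : u.length ≤ z.length := Nat.le_of_not_lt hcon
  unfold GenPal at hx hypal hzpal
  have hinv : ∀ l : List α, (l.map f).map f = l := by
    intro l
    rw [List.map_map, hf.comp_self, List.map_id]
  have hvpos : 0 < v.length := by
    rcases v with _ | ⟨a, v⟩
    · exact absurd (by simpa using hv.symm) hzne
    · simp
  obtain ⟨u', hu'⟩ : ∃ u', u' = u.reverse.map f := ⟨_, rfl⟩
  have hlu : u'.length = u.length := by simp [hu']
  have hx1 : x = v ++ (z ++ u') := by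
    have h1 : x = y.reverse.map f ++ u' := by
      rw [hu', ← List.map_append, ← List.reverse_append, ← hu]
      exact hx
    rw [← hypal, hv, List.append_assoc] at h1
    exact h1
  have hx2 : x = (u ++ v) ++ z := by rw [hu, hv, List.append_assoc]
  have hws : z ++ u' <:+ x := ⟨v, hx1.symm⟩
  have hzs : z <:+ x := ⟨u ++ v, hx2.symm⟩
  obtain ⟨t, ht⟩ : z <:+ z ++ u' :=
    List.suffix_of_suffix_length_le hzs hws (by simp)
  obtain ⟨s, hs⟩ : u' <:+ z :=
    List.suffix_of_suffix_length_le ((List.suffix_append z u').trans hws) hzs (by omega)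
  have hz2 : z = u ++ s.reverse.map f := by
    have h2 := hzpal
    rw [← hs, List.reverse_append, List.map_append, hu', ← List.map_reverse,
      List.reverse_reverse, hinv, ← hu', hs] at h2
    exact h2
  have htl : t.length = u.length := by
    have := congrArg List.length ht
    simp only [List.length_append] at this
    omega
  have htu : t = u := by
    have h3 : t ++ z = u ++ (s.reverse.map f ++ u') := by
      rw [ht, ← List.append_assoc, ← hz2]
    exact (List.append_inj h3 htl).1
  have hpal : GenPal f (z ++ u') := by
    unfold GenPal
    rw [List.reverse_append, List.map_append, ← hzpal, hu', ← List.map_reverse,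
      List.reverse_reverse, hinv, ← hu', ← ht, htu]
  have hle := hymax _ hws (by
    intro h
    have h4 := congrArg List.length hx1
    rw [List.length_append, h] at h4
    omega) hpal
  rw [hv] at hle
  simp only [List.length_append] at hle
  omega
end

section
/- Let x be a nonempty generalized palindrome, y the longest proper suffix of x that is a generalized palindrome, and (assuming y is nonempty) z the longest proper suffix of y that is a generalized palindrome. Let u and v be the strings with x = u·y and y = v·z. If |u| = |v|, then u = v. -/
/-- Let `x` be a nonempty generalized palindrome, `y` the longest proper suffix of `x`
that is a generalized palindrome (assumed nonempty), `z` the longest proper suffix of `y`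
that is a generalized palindrome, and `u`, `v` with `x = u ++ y`, `y = v ++ z`.
If `|u| = |v|`, then `u = v`. -/
theorem u_eq_v_of_length_eq {α : Type*} (f : α → α) (hf : Function.Involutive f)
    (x y z u v : List α)
    (hx : GenPal f x) (hxne : x ≠ [])
    (hysuf : y <:+ x) (hyne : y ≠ x) (hypal : GenPal f y)
    (hymax : ∀ y' : List α, y' <:+ x → y' ≠ x → GenPal f y' → y'.length ≤ y.length)
    (hyne' : y ≠ [])
    (hzsuf : z <:+ y) (hzne : z ≠ y) (hzpal : GenPal f z)
    (hzmax : ∀ z' : List α, z' <:+ y → z' ≠ y → GenPal f z' → z'.length ≤ z.length)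
    (hu : x = u ++ y) (hv : y = v ++ z)
    (heq : u.length = v.length) :
    u = v := by
  have h1 : x = y ++ (u.reverse).map f := by
    have h := hx
    unfold GenPal at h hypal
    rw [h, hu, List.reverse_append, List.map_append, ← hypal]
  have h2 : u ++ y = v ++ (z ++ (u.reverse).map f) := by
    rw [← List.append_assoc, ← hv, ← h1, hu]
  exact List.append_inj_left h2 heq
end

section
/- Let S be a string of length n and 1 ≤ j ≤ n. If p < q < r are elements of P_j such that no element of P_j lies strictly between p and q and no element of P_j lies strictly between q and r, then q − p ≥ r − q. In other words, the sequence of consecutive differences of the sorted list P_j is non-increasing. -/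
/-- `factor S i j` is the factor `S[i..j]` of `S` (1-based indexing). -/
def factor {α : Type*} (S : List α) (i j : ℕ) : List α :=
  (S.take j).drop (i - 1)

/-- `Pset f S j` is the set of starting positions of generalized palindromes
ending at position `j` of `S`. -/
def Pset {α : Type*} (f : α → α) (S : List α) (j : ℕ) : Set ℕ :=
  {i | 1 ≤ i ∧ i ≤ j ∧ GenPal f (factor S i j)}

theorem genPal_factor_iff {α : Type*} (f : α → α) (S : List α) (i j : ℕ)
    (hi : 1 ≤ i) (hij : i ≤ j) (hjn : j ≤ S.length) :
    GenPal f (factor S i j) ↔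
      ∀ k, i ≤ k → k ≤ j → S[k - 1]? = (S[i + j - k - 1]?).map f := by
  have hlen : (factor S i j).length = j + 1 - i := by
    simp only [factor, List.length_drop, List.length_take]; omega
  have hget : ∀ m, m < j + 1 - i → (factor S i j)[m]? = S[i - 1 + m]? := by
    intro m hm
    simp only [factor, List.getElem?_drop]
    rw [List.getElem?_take_of_lt (by omega)]
  have hrev : ∀ m, m < j + 1 - i →
      ((factor S i j).reverse.map f)[m]? = (S[j - 1 - m]?).map f := by
    intro m hm
    rw [List.getElem?_map, List.getElem?_reverse (by omega), hlen, hget _ (by omega)]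
    congr 2
    omega
  unfold GenPal
  constructor
  · intro h k h1 h2
    have h3 := congrArg (fun l => l[k - i]?) h
    rw [hget _ (by omega), hrev _ (by omega)] at h3
    rw [show k - 1 = i - 1 + (k - i) by omega, h3]
    congr 2
    omega
  · intro h
    apply List.ext_getElem?
    intro m
    by_cases hm : m < j + 1 - i
    · rw [hget m hm, hrev m hm]
      have := h (i + m) (by omega) (by omega)
      rw [show i - 1 + m = i + m - 1 by omega, this]
      congr 2
      omega
    · rw [List.getElem?_eq_none (by omega), List.getElem?_eq_none (by simp [hlen]; omega)]

/-- If `p < q < r` are elements of `P_j` with no element of `P_j` strictly between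
`p` and `q` nor between `q` and `r`, then `q − p ≥ r − q`: the sequence of consecutive
differences of the sorted list `P_j` is non-increasing. -/
theorem consecutive_differences_nonincreasing {α : Type*} (f : α → α)
    (hf : Function.Involutive f) (S : List α) (j : ℕ)
    (hj1 : 1 ≤ j) (hjn : j ≤ S.length) (p q r : ℕ)
    (hp : p ∈ Pset f S j) (hq : q ∈ Pset f S j) (hr : r ∈ Pset f S j)
    (hpq : p < q) (hqr : q < r)
    (hgap1 : ∀ m ∈ Pset f S j, ¬(p < m ∧ m < q))
    (hgap2 : ∀ m ∈ Pset f S j, ¬(q < m ∧ m < r)) :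
    r - q ≤ q - p := by
  by_contra hlt
  obtain ⟨hp1, hp2, hp3⟩ := hp
  obtain ⟨hq1, hq2, hq3⟩ := hq
  obtain ⟨hr1, hr2, -⟩ := hr
  rw [genPal_factor_iff f S _ j hp1 hp2 hjn] at hp3
  rw [genPal_factor_iff f S _ j hq1 hq2 hjn] at hq3
  refine hgap2 (q + (q - p)) ⟨by omega, by omega, ?_⟩ ⟨by omega, by omega⟩
  rw [genPal_factor_iff f S _ j (by omega) (by omega) hjn]
  intro k h1 h2
  rw [hq3 k (by omega) h2, hp3 (q + j - k) (by omega) (by omega),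
    show p + j - (q + j - k) - 1 = (k - (q - p)) - 1 by omega,
    hq3 (k - (q - p)) (by omega) (by omega),
    show q + j - (k - (q - p)) - 1 = q + (q - p) + j - k - 1 by omega]
  simp only [Option.map_map, hf.comp_self, Function.comp_id, Function.id_comp]
end

section
/- Let S be a string of length n, 1 ≤ j ≤ n, Δ ≥ 1, i ≥ 1 and k ≥ 2. If P_{j,Δ} = { i + sΔ : 0 ≤ s ≤ k−1 }, then P_{j−Δ,Δ} = { i + sΔ : 0 ≤ s ≤ k−2 }. (In the triple representation: if (i,Δ,k) ∈ G_j and k ≥ 2, then (i,Δ,k−1) ∈ G_{j−Δ}.) -/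
/-- `PsetD f S j Δ` is `P_{j,Δ}`: the elements `i` of `P_j` whose predecessor
in `P_j` is exactly `i − Δ`. -/
def PsetD {α : Type*} (f : α → α) (S : List α) (j Δ : ℕ) : Set ℕ :=
  {i | i ∈ Pset f S j ∧ i - Δ ∈ Pset f S j ∧
    ∀ m ∈ Pset f S j, ¬(i - Δ < m ∧ m < i)}

theorem mem_Pset_iff {α : Type*} (f : α → α) (S : List α) (i j : ℕ) (hjn : j ≤ S.length) :
    i ∈ Pset f S j ↔ 1 ≤ i ∧ i ≤ j ∧ ∀ x y, x + y = i + j → i ≤ x → i ≤ y →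
      S[x-1]? = (S[y-1]?).map f := by
  unfold Pset GenPal factor
  simp only [Set.mem_setOf_eq]
  refine and_congr_right fun h1 => and_congr_right fun h2 => ?_
  have hlen : ((S.take j).drop (i - 1)).length = j - (i - 1) := by
    simp [hjn]
  have e1 : ∀ n, n < j - (i-1) → ((S.take j).drop (i - 1))[n]? = S[i - 1 + n]? := by
    intro n hn
    rw [List.getElem?_drop, List.getElem?_take, if_pos (by omega)]
  have e2 : ∀ n, n < j - (i-1) → (((S.take j).drop (i - 1)).reverse.map f)[n]?
      = (S[j - 1 - n]?).map f := by
    intro n hn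
    rw [List.getElem?_map, List.getElem?_reverse (by omega), hlen, e1 _ (by omega)]
    congr 2
    omega
  constructor
  · intro h x y hxy hx hy
    have a := e1 (x - i) (by omega)
    have b := e2 (x - i) (by omega)
    rw [← h, a] at b
    rwa [show i - 1 + (x - i) = x - 1 by omega, show j - 1 - (x - i) = y - 1 by omega] at b
  · intro h
    apply List.ext_getElem?
    intro n
    by_cases hn : n < j - (i - 1)
    · rw [e1 n hn, e2 n hn]
      have := h (i + n) (j - n) (by omega) (by omega) (by omega)
      rwa [show i + n - 1 = i - 1 + n by omega, show j - n - 1 = j - 1 - n by omega] at this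
    · rw [List.getElem?_eq_none (by omega), List.getElem?_eq_none]
      rw [List.length_map, List.length_reverse]
      omega

/-- Palindromicity of `T[a..b]`. -/
def PalT {β : Type*} (T : ℕ → β) (g : β → β) (a b : ℕ) : Prop :=
  ∀ x y, x + y = a + b → a ≤ x → a ≤ y → T x = g (T y)

/-- Period `d` of `T[a..b]`. -/
def PerT {β : Type*} (T : ℕ → β) (d a b : ℕ) : Prop :=
  ∀ x, a ≤ x → x + d ≤ b → T x = T (x + d)

theorem PerT_of {β : Type*} {T : ℕ → β} {g : β → β} {a b d : ℕ}
    (h1 : PalT T g a b) (h2 : PalT T g (a + d) b) : PerT T d a b := by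
  intro x hx hxb
  rw [h1 x (a + b - x) (by omega) hx (by omega),
    h2 (x + d) (a + b - x) (by omega) (by omega) (by omega)]

theorem PalT_shrink {β : Type*} {T : ℕ → β} {g : β → β} {a b d : ℕ}
    (h1 : PalT T g a b) (h2 : PerT T d a b) : PalT T g (a + d) b := by
  intro x y hxy hx hy
  rw [h1 x (y - d) (by omega) (by omega) (by omega), h2 (y - d) (by omega) (by omega)]
  congr 2; omega

theorem PalT_extend {β : Type*} {T : ℕ → β} {g : β → β} (hg : Function.Involutive g)
    {a b d : ℕ} (hab : a + d ≤ b + 1) (hab2 : a + 2 * d ≤ b + 1)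
    (h1 : PalT T g (a + d) b) (h2 : PerT T d a b) : PalT T g a b := by
  have key : ∀ x y, x + y = a + b → a ≤ x → a ≤ y → x + d ≤ b → T x = g (T y) := by
    intro x y hxy hx hy hxd
    rw [h2 x hx hxd, h1 (x + d) y (by omega) (by omega) (by omega)]
  intro x y hxy hx hy
  by_cases c : x + d ≤ b
  · exact key x y hxy hx hy c
  · rw [key y x (by omega) hy hx (by omega), hg]

theorem PalT_shift {β : Type*} {T : ℕ → β} {g : β → β} {a m b d : ℕ}
    (h2 : PerT T d a (b + d)) (hm : a ≤ m) :
    PalT T g m b ↔ PalT T g (m + d) (b + d) := by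
  constructor
  · intro h x y hxy hx hy
    have := h (x - d) (y - d) (by omega) (by omega) (by omega)
    rw [h2 (x - d) (by omega) (by omega), h2 (y - d) (by omega) (by omega)] at this
    rwa [show x - d + d = x by omega, show y - d + d = y by omega] at this
  · intro h x y hxy hx hy
    rw [h2 x (by omega) (by omega), h2 y (by omega) (by omega)]
    exact h _ _ (by omega) (by omega) (by omega)

/-- If `P_{j,Δ} = {i + sΔ : 0 ≤ s ≤ k−1}` with `k ≥ 2`, then
`P_{j−Δ,Δ} = {i + sΔ : 0 ≤ s ≤ k−2}`. (If `(i,Δ,k) ∈ G_j` and `k ≥ 2`,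
then `(i,Δ,k−1) ∈ G_{j−Δ}`.) -/
theorem PsetD_pred {α : Type*} (f : α → α) (hf : Function.Involutive f)
    (S : List α) (j Δ i k : ℕ)
    (hj1 : 1 ≤ j) (hjn : j ≤ S.length) (hΔ : 1 ≤ Δ) (hi : 1 ≤ i) (hk : 2 ≤ k)
    (h : PsetD f S j Δ = {m | ∃ s ≤ k - 1, m = i + s * Δ}) :
    PsetD f S (j - Δ) Δ = {m | ∃ s ≤ k - 2, m = i + s * Δ} := by
  obtain ⟨T, hT⟩ : ∃ T : ℕ → Option α, T = fun x => S[x-1]? := ⟨_, rfl⟩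
  obtain ⟨g, hgd⟩ : ∃ g : Option α → Option α, g = Option.map f := ⟨_, rfl⟩
  have hg : Function.Involutive g := by
    intro o
    subst hgd
    cases o <;> simp [hf _]
  have P : ∀ b ≤ j, ∀ m, m ∈ Pset f S b ↔ 1 ≤ m ∧ m ≤ b ∧ PalT T g m b := by
    intro b hb m
    rw [mem_Pset_iff f S m b (by omega)]
    subst hT hgd
    rfl
  have mem0 : i ∈ PsetD f S j Δ := by rw [h]; exact ⟨0, by omega, by simp⟩
  have mem1 : i + Δ ∈ PsetD f S j Δ := by rw [h]; exact ⟨1, by omega, by simp⟩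
  obtain ⟨i0, i1, i2⟩ := mem0
  obtain ⟨j0, -, j2⟩ := mem1
  rw [P j le_rfl] at i0 i1 j0
  obtain ⟨a, rfl⟩ : ∃ a, i = a + Δ := ⟨i - Δ, by omega⟩
  obtain ⟨b, rfl⟩ : ∃ b, j = b + Δ := ⟨j - Δ, by omega⟩
  simp only [Nat.add_sub_cancel] at *
  have per : PerT T Δ a (b + Δ) := PerT_of i1.2.2 i0.2.2
  -- shifting membership
  have shift : ∀ m, a ≤ m → (m ∈ Pset f S b ↔ m + Δ ∈ Pset f S (b + Δ)) := by
    intro m hm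
    rw [P b (by omega), P (b + Δ) le_rfl, ← PalT_shift per hm]
    constructor
    · rintro ⟨_, _, h⟩; exact ⟨by omega, by omega, h⟩
    · rintro ⟨_, _, h⟩; exact ⟨by omega, by omega, h⟩
  have shiftD : ∀ m, a + Δ ≤ m → (m ∈ PsetD f S b Δ ↔ m + Δ ∈ PsetD f S (b + Δ) Δ) := by
    intro m hm
    unfold PsetD
    simp only [Set.mem_setOf_eq]
    rw [shift m (by omega), shift (m - Δ) (by omega), show m - Δ + Δ = m by omega,
      Nat.add_sub_cancel]
    refine and_congr_right fun _ => and_congr_right fun _ => ?_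
    constructor
    · intro H x hx hlt
      refine H (x - Δ) ?_ (by omega)
      rw [shift _ (by omega), show x - Δ + Δ = x by omega]
      exact hx
    · intro H x hx hlt
      exact H (x + Δ) ((shift x (by omega)).1 hx) (by omega)
  have low : ∀ m ∈ PsetD f S b Δ, a + Δ ≤ m := by
    intro m hm
    by_contra hlt
    have aP : a ∈ Pset f S b := by
      rw [shift a le_rfl, P _ le_rfl]; exact i0
    obtain ⟨m0, m1, m2⟩ := hm
    by_cases hma : a < m
    · exact j2 (m + Δ) ((shift m (by omega)).1 m0) (by omega)
    rw [P b (by omega)] at m0 m1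
    obtain ⟨c, rfl⟩ : ∃ c, m = c + Δ := ⟨m - Δ, by omega⟩
    rw [Nat.add_sub_cancel] at m1
    have perc : PerT T Δ c b := PerT_of m1.2.2 m0.2.2
    have perall : PerT T Δ c (b + Δ) := by
      intro x hx hxb
      by_cases hxa : a ≤ x
      · exact per x hxa hxb
      · exact perc x hx (by omega)
    obtain ⟨e, rfl⟩ : ∃ e, a = e + Δ := ⟨a - Δ, by omega⟩
    have pere : PerT T Δ e (b + Δ) := fun x hx => perall x (by omega)
    have pale : PalT T g e (b + Δ) :=
      PalT_extend hg (by omega) (by omega) i1.2.2 pere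
    have hin : e + Δ ∈ PsetD f S (b + Δ) Δ := by
      refine ⟨(P _ le_rfl _).2 i1, ?_, ?_⟩
      · rw [Nat.add_sub_cancel, P _ le_rfl]
        exact ⟨by omega, by omega, pale⟩
      · intro x hx hlt
        rw [Nat.add_sub_cancel] at hlt
        rw [P _ le_rfl] at hx
        refine i2 (x + Δ) ?_ (by omega)
        rw [P _ le_rfl]
        exact ⟨by omega, by omega,
          PalT_shrink hx.2.2 (fun y hy => pere y (by omega))⟩
    rw [h] at hin
    obtain ⟨s, -, hs⟩ := hin
    omega
  ext m
  constructor
  · intro hm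
    have hl := low m hm
    rw [shiftD m hl, h] at hm
    obtain ⟨s, hs, hms⟩ := hm
    rcases s with _ | s
    · omega
    · refine ⟨s, by omega, ?_⟩
      rw [Nat.succ_mul] at hms
      omega
  · rintro ⟨s, hs, rfl⟩
    rw [shiftD _ (by omega), h]
    exact ⟨s + 1, by omega, by rw [Nat.succ_mul]; omega⟩
end

section
/- Let S be a string of length n, F a set of index pairs (a,b) with 1 ≤ a ≤ b ≤ n (representing a set of factors of S), and let MG and MG' be as defined. Then for all 1 ≤ j ≤ n and q ≥ 0: MG(j,q) = min( MG'(j,q), min{ MG(a−1, q) : (a,j) ∈ F } ), where the inner minimum is ∞ if no pair of the form (a,j) belongs to F. -/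
/-- The number of gaps (connected components, i.e. maximal runs of consecutive
integers) of a finite set `G` of positive positions. -/
def gapCount (G : Finset ℕ) : ℕ :=
  (G.filter (fun x => x - 1 ∉ G)).card

/-- `G` is the gap set of a `(q,F)`-factorization of `S[1..j]`: `G ⊆ {1,…,j}`,
`G` has at most `q` connected components (gaps), and `{1,…,j} \ G` can be
partitioned into intervals `[a..b]` with `(a,b) ∈ F`. -/
def IsFact (F : Set (ℕ × ℕ)) (j q : ℕ) (G : Finset ℕ) : Prop :=
  G ⊆ Finset.Icc 1 j ∧ gapCount G ≤ q ∧
    ∃ P : Finset (ℕ × ℕ), ↑P ⊆ F ∧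
      (∀ p ∈ P, ∀ p' ∈ P, p ≠ p' →
        Disjoint (Finset.Icc p.1 p.2) (Finset.Icc p'.1 p'.2)) ∧
      P.biUnion (fun p => Finset.Icc p.1 p.2) = Finset.Icc 1 j \ G

/-- `MG F j q` is the minimum total gap length over all `(q,F)`-factorizations of
`S[1..j]` (`∞` if none exists). -/
noncomputable def MG (F : Set (ℕ × ℕ)) (j q : ℕ) : ℕ∞ :=
  sInf {c : ℕ∞ | ∃ G : Finset ℕ, IsFact F j q G ∧ c = (G.card : ℕ∞)}

/-- `MG' F j q` is the minimum total gap length over all `(q,F)`-factorizations of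
`S[1..j]` in which position `j` belongs to a gap (`∞` if none exists). -/
noncomputable def MG' (F : Set (ℕ × ℕ)) (j q : ℕ) : ℕ∞ :=
  sInf {c : ℕ∞ | ∃ G : Finset ℕ, IsFact F j q G ∧ j ∈ G ∧ c = (G.card : ℕ∞)}

theorem IsFact.extend {F : Set (ℕ × ℕ)} {a j q : ℕ} {G : Finset ℕ} (ha : 1 ≤ a) (haj : a ≤ j)
    (h : (a, j) ∈ F) (hG : IsFact F (a - 1) q G) : IsFact F j q G := by
  obtain ⟨h1, h2, P, hPF, hd, hu⟩ := hG
  have hle : ∀ p ∈ P, ∀ x, p.1 ≤ x → x ≤ p.2 → x ≤ a - 1 := by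
    intro p hp x hx1 hx2
    have : x ∈ P.biUnion (fun p => Finset.Icc p.1 p.2) :=
      Finset.mem_biUnion.2 ⟨p, hp, Finset.mem_Icc.2 ⟨hx1, hx2⟩⟩
    rw [hu] at this
    simp only [Finset.mem_sdiff, Finset.mem_Icc] at this
    exact this.1.2
  have hdn : ∀ p ∈ P, Disjoint (Finset.Icc p.1 p.2) (Finset.Icc a j) := by
    intro p hp
    rw [Finset.disjoint_left]
    intro x hx hx'
    rw [Finset.mem_Icc] at hx hx'
    have := hle p hp x hx.1 hx.2
    omega
  refine ⟨fun x hx => ?_, h2, insert (a, j) P, ?_, ?_, ?_⟩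
  · have := Finset.mem_Icc.1 (h1 hx)
    rw [Finset.mem_Icc]; omega
  · intro p hp
    rw [Finset.mem_coe, Finset.mem_insert] at hp
    rcases hp with rfl | hp
    · exact h
    · exact hPF hp
  · intro p hp p' hp' hne
    rw [Finset.mem_insert] at hp hp'
    rcases hp with rfl | hp <;> rcases hp' with rfl | hp'
    · exact absurd rfl hne
    · exact (hdn _ hp').symm
    · exact hdn _ hp
    · exact hd _ hp _ hp' hne
  · rw [Finset.biUnion_insert, hu]
    ext x
    have hx : x ∈ G → 1 ≤ x ∧ x ≤ a - 1 := fun hx => Finset.mem_Icc.1 (h1 hx)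
    simp only [Finset.mem_union, Finset.mem_sdiff, Finset.mem_Icc]
    by_cases hxG : x ∈ G
    · have := hx hxG
      simp only [hxG, not_true, and_false, or_false, iff_false]
      omega
    · simp only [hxG, not_false_iff, and_true]
      omega

theorem IsFact.restrict {F : Set (ℕ × ℕ)} {n j q : ℕ} {G : Finset ℕ}
    (hF : ∀ p ∈ F, 1 ≤ p.1 ∧ p.1 ≤ p.2 ∧ p.2 ≤ n) (hj : 1 ≤ j)
    (hG : IsFact F j q G) (hjG : j ∉ G) : ∃ a, (a, j) ∈ F ∧ IsFact F (a - 1) q G := by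
  obtain ⟨h1, h2, P, hPF, hd, hu⟩ := hG
  have hmem : ∀ x, (∃ p ∈ P, p.1 ≤ x ∧ x ≤ p.2) ↔ ((1 ≤ x ∧ x ≤ j) ∧ x ∉ G) := by
    intro x
    have := Finset.ext_iff.1 hu x
    simpa only [Finset.mem_biUnion, Finset.mem_sdiff, Finset.mem_Icc] using this
  obtain ⟨⟨a, b⟩, hp, hpa, hpb⟩ := (hmem j).2 ⟨⟨hj, le_rfl⟩, hjG⟩
  have hab := hF _ (hPF hp)
  have hb := ((hmem b).1 ⟨_, hp, hab.2.1, le_rfl⟩).1.2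
  dsimp only at hpa hpb hab
  obtain rfl : b = j := le_antisymm hb hpb
  refine ⟨a, hPF hp, fun x hx => ?_, h2, P.erase (a, b), ?_, ?_, ?_⟩
  · have hx1 := Finset.mem_Icc.1 (h1 hx)
    rw [Finset.mem_Icc]
    by_contra hcon
    exact ((hmem x).1 ⟨_, hp, by dsimp only; omega, hx1.2⟩).2 hx
  · intro p hp
    exact hPF (Finset.mem_of_mem_erase hp)
  · intro p hp p' hp' hne
    exact hd _ (Finset.mem_of_mem_erase hp) _ (Finset.mem_of_mem_erase hp') hne
  · ext x
    simp only [Finset.mem_biUnion, Finset.mem_sdiff, Finset.mem_Icc]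
    constructor
    · rintro ⟨p, hpe, hx⟩
      have hpP := Finset.mem_of_mem_erase hpe
      have hne := Finset.ne_of_mem_erase hpe
      have h3 := (hmem x).1 ⟨p, hpP, hx⟩
      have h4 := Finset.disjoint_left.1 (hd _ hpP _ hp hne) (Finset.mem_Icc.2 hx)
      rw [Finset.mem_Icc] at h4
      dsimp only at h4
      exact ⟨by omega, h3.2⟩
    · rintro ⟨hx, hxG⟩
      obtain ⟨p, hpP, hxp⟩ := (hmem x).2 ⟨by omega, hxG⟩
      refine ⟨p, Finset.mem_erase.2 ⟨?_, hpP⟩, hxp⟩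
      rintro rfl
      dsimp only at hxp
      omega

/-- For all `1 ≤ j ≤ n` and `q ≥ 0`:
`MG(j,q) = min(MG'(j,q), min{ MG(a−1,q) : (a,j) ∈ F })`,
the inner minimum being `∞` if no pair `(a,j)` belongs to `F`. -/
theorem MG_recurrence {α : Type*} (S : List α) (F : Set (ℕ × ℕ))
    (hF : ∀ p ∈ F, 1 ≤ p.1 ∧ p.1 ≤ p.2 ∧ p.2 ≤ S.length)
    (j q : ℕ) (hj1 : 1 ≤ j) (hjn : j ≤ S.length) :
    MG F j q =
      min (MG' F j q) (sInf {c : ℕ∞ | ∃ a : ℕ, (a, j) ∈ F ∧ c = MG F (a - 1) q}) := by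
  apply le_antisymm
  · refine le_min ?_ ?_
    · refine sInf_le_sInf ?_
      rintro c ⟨G, hG, -, rfl⟩
      exact ⟨G, hG, rfl⟩
    · refine le_sInf ?_
      rintro c ⟨a, ha, rfl⟩
      refine sInf_le_sInf ?_
      rintro c ⟨G, hG, rfl⟩
      have := hF _ ha
      exact ⟨G, hG.extend this.1 this.2.1 ha, rfl⟩
  · refine le_sInf ?_
    rintro c ⟨G, hG, rfl⟩
    by_cases hjG : j ∈ G
    · exact (min_le_left _ _).trans (sInf_le ⟨G, hG, hjG, rfl⟩)
    · obtain ⟨a, ha, hG'⟩ := hG.restrict hF hj1 hjG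
      refine (min_le_right _ _).trans (le_trans (b := MG F (a - 1) q) ?_ ?_)
      · exact sInf_le ⟨a, ha, rfl⟩
      · exact sInf_le ⟨G, hG', rfl⟩
end

section
/- Let S be a string of length n, F a set of index pairs (a,b) with 1 ≤ a ≤ b ≤ n (representing a set of factors of S), and let MG and MG' be as defined. Then for all 1 ≤ j ≤ n and q ≥ 1: MG'(j,q) = min( MG(j−1, q−1), MG'(j−1, q) ) + 1. -/
theorem gapCount_insert_aux (k : ℕ) (G : Finset ℕ) (hG : G ⊆ Finset.Icc 1 k) :
    gapCount (insert (k+1) G) = gapCount G + if k ∈ G then 0 else 1 := by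
  have hk : k + 1 ∉ G := fun h => by
    have := Finset.mem_Icc.1 (hG h)
    omega
  have h1 : G.filter (fun x => x - 1 ∉ insert (k+1) G) = G.filter (fun x => x - 1 ∉ G) := by
    apply Finset.filter_congr
    intro x hx
    have := Finset.mem_Icc.1 (hG hx)
    have h2 : x - 1 ≠ k + 1 := by omega
    simp [h2]
  unfold gapCount
  rw [Finset.filter_insert, h1]
  by_cases h : k ∈ G
  · simp [h]
  · simp [h, hk]

theorem isFact_insert_aux (F : Set (ℕ × ℕ)) (k q r : ℕ) (G : Finset ℕ)
    (hG : G ⊆ Finset.Icc 1 k) (h : gapCount (insert (k+1) G) ≤ q ↔ gapCount G ≤ r) :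
    IsFact F (k+1) q (insert (k+1) G) ↔ IsFact F k r G := by
  have h1 : insert (k+1) G ⊆ Finset.Icc 1 (k+1) := by
    intro x hx
    rcases Finset.mem_insert.1 hx with rfl | hx
    · simp
    · have := Finset.mem_Icc.1 (hG hx)
      simp; omega
  have h2 : Finset.Icc 1 (k+1) \ insert (k+1) G = Finset.Icc 1 k \ G := by
    ext x
    simp only [Finset.mem_sdiff, Finset.mem_Icc, Finset.mem_insert, not_or]
    constructor
    · rintro ⟨a, b, c⟩
      exact ⟨by omega, c⟩
    · rintro ⟨a, c⟩
      exact ⟨by omega, by omega, c⟩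
  unfold IsFact
  rw [h2, h]
  simp only [h1, hG, true_and]

/-- For all `1 ≤ j ≤ n` and `q ≥ 1`:
`MG'(j,q) = min(MG(j−1,q−1), MG'(j−1,q)) + 1` (with `∞ + 1 = ∞`). -/
theorem MG'_recurrence {α : Type*} (S : List α) (F : Set (ℕ × ℕ))
    (hF : ∀ p ∈ F, 1 ≤ p.1 ∧ p.1 ≤ p.2 ∧ p.2 ≤ S.length)
    (j q : ℕ) (hj1 : 1 ≤ j) (hjn : j ≤ S.length) (hq : 1 ≤ q) :
    MG' F j q = min (MG F (j - 1) (q - 1)) (MG' F (j - 1) q) + 1 := by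
  obtain ⟨k, rfl⟩ : ∃ k, j = k + 1 := ⟨j - 1, by omega⟩
  obtain ⟨r, rfl⟩ : ∃ r, q = r + 1 := ⟨q - 1, by omega⟩
  simp only [Nat.add_sub_cancel]
  have key : ∀ G : Finset ℕ, G ⊆ Finset.Icc 1 k →
      k + 1 ∉ G := fun G hG h => by
    have := Finset.mem_Icc.1 (hG h)
    omega
  apply le_antisymm
  · -- upper bound
    have hle : ∀ G : Finset ℕ, IsFact F (k+1) (r+1) (insert (k+1) G) → k + 1 ∉ G →
        MG' F (k+1) (r+1) ≤ (G.card : ℕ∞) + 1 := by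
      intro G hG hk
      apply sInf_le
      refine ⟨_, hG, Finset.mem_insert_self _ _, ?_⟩
      rw [Finset.card_insert_of_notMem hk]
      push_cast
      rfl
    have hmono : ∀ s : Set ℕ∞, (∀ c ∈ s, MG' F (k+1) (r+1) ≤ c + 1) →
        MG' F (k+1) (r+1) ≤ sInf s + 1 := by
      intro s hs
      rcases s.eq_empty_or_nonempty with rfl | hne
      · simp
      · exact hs _ (csInf_mem hne)
    rw [← min_add_add_right]
    apply le_min
    · apply hmono
      rintro c ⟨G, hG, rfl⟩
      have hc := gapCount_insert_aux k G hG.1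
      apply hle G _ (key G hG.1)
      have hs : IsFact F k (gapCount G) G := ⟨hG.1, le_rfl, hG.2.2⟩
      have h3 := (isFact_insert_aux F k (gapCount (insert (k+1) G)) (gapCount G) G hG.1
        (by simp)).2 hs
      refine ⟨h3.1, ?_, h3.2.2⟩
      have := hG.2.1
      split_ifs at hc <;> omega
    · apply hmono
      rintro c ⟨G, hG, hk, rfl⟩
      have hc := gapCount_insert_aux k G hG.1
      rw [if_pos hk] at hc
      exact hle G ((isFact_insert_aux F k (r+1) (r+1) G hG.1 (by rw [hc]; rfl)).2 hG)
        (key G hG.1)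
  · apply le_sInf
    rintro c ⟨G', hG', hj, rfl⟩
    obtain ⟨G, hk, rfl⟩ : ∃ G, k + 1 ∉ G ∧ G' = insert (k+1) G :=
      ⟨G'.erase (k+1), by simp, (Finset.insert_erase hj).symm⟩
    have hG : G ⊆ Finset.Icc 1 k := by
      intro x hx
      have h1 := Finset.mem_Icc.1 (hG'.1 (Finset.mem_insert_of_mem hx))
      have h2 : x ≠ k + 1 := fun h => hk (h ▸ hx)
      rw [Finset.mem_Icc]
      omega
    have hc := gapCount_insert_aux k G hG
    rw [Finset.card_insert_of_notMem hk]
    push_cast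
    gcongr
    by_cases h : k ∈ G
    · rw [if_pos h] at hc
      apply min_le_of_right_le
      exact sInf_le ⟨G, (isFact_insert_aux F k (r+1) (r+1) G hG (by rw [hc]; rfl)).1 hG', h, rfl⟩
    · rw [if_neg h] at hc
      apply min_le_of_left_le
      exact sInf_le ⟨G, (isFact_insert_aux F k (r+1) r G hG (by rw [hc]; omega)).1 hG', rfl⟩
end
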